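/- Let t > 0 and 0 ≤ a ≤ b ≤ c ≤ d ≤ t. Let X : [0,t] × Ω → ℝ² be a jointly measurable stochastic process such that every finite family (X_{t_1}, …, X_{t_m}) is centered Gaussian with E[X_s^{(i)} X_r^{(j)}] = 𝟙_{i=j}(min(s,r) − sr/t) (a two-dimensional Brownian bridge from 0 at time 0 to 0 at time t). Then lim_{ε→0+} ∫_c^d ∫_a^b E[p_ε(X_s − X_r)] dr ds = (2π)^{−1} [ ∫_{c−a}^{d−a} (log s − log(t−s)) ds − ∫_{c−b}^{d−b} (log s − log(t−s)) ds ]. -/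

import Mathlib

open MeasureTheory ProbabilityTheory Filter Topology

/-- The two-dimensional heat kernel `p_ε(x) = (2πε)⁻¹ exp(-|x|²/(2ε))` on `ℝ² = ℝ × ℝ`. -/
noncomputable def pHeat (ε : ℝ) (x : ℝ × ℝ) : ℝ :=
  (2 * Real.pi * ε)⁻¹ * Real.exp (-(x.1 ^ 2 + x.2 ^ 2) / (2 * ε))

/-- The Laplace transform of the square of a centered real Gaussian variable. -/
lemma integral_exp_neg_sq_gaussianReal {ε : ℝ} (hε : 0 < ε) (v : NNReal) :
    ∫ x, Real.exp (-x ^ 2 / (2 * ε)) ∂(gaussianReal 0 v) = √(ε / (v + ε)) := by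
  rcases eq_or_ne v 0 with rfl | hv
  · simp [gaussianReal_zero_var, hε.ne']
  have hv' : (0 : ℝ) < v := by exact_mod_cast pos_iff_ne_zero.mpr hv
  rw [integral_gaussianReal_eq_integral_smul hv]
  have hfun (x : ℝ) : gaussianPDFReal 0 v x • Real.exp (-x ^ 2 / (2 * ε))
      = (√(2 * Real.pi * v))⁻¹ * Real.exp (-((v + ε) / (2 * v * ε)) * x ^ 2) := by
    rw [gaussianPDFReal_def, smul_eq_mul, mul_assoc, ← Real.exp_add]
    congr 2
    field_simp
    ring
  simp_rw [hfun]
  rw [integral_const_mul, integral_gaussian, ← Real.sqrt_inv, ← Real.sqrt_mul (by positivity)]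
  congr 1
  field_simp

/-- The mean of the heat kernel under an isotropic centered Gaussian measure on the plane. -/
lemma integral_pHeat_gaussianReal_prod {ε : ℝ} (hε : 0 < ε) (v : NNReal) :
    ∫ x, pHeat ε x ∂((gaussianReal 0 v).prod (gaussianReal 0 v))
      = (2 * Real.pi * (v + ε))⁻¹ := by
  have hfun (x : ℝ × ℝ) : pHeat ε x = (2 * Real.pi * ε)⁻¹ *
      (Real.exp (-x.1 ^ 2 / (2 * ε)) * Real.exp (-x.2 ^ 2 / (2 * ε))) := by
    rw [pHeat, ← Real.exp_add]
    congr 2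
    ring
  simp_rw [hfun]
  rw [integral_const_mul, integral_prod_mul (fun x : ℝ => Real.exp (-x ^ 2 / (2 * ε)))
    (fun x : ℝ => Real.exp (-x ^ 2 / (2 * ε))), integral_exp_neg_sq_gaussianReal hε,
    Real.mul_self_sqrt (by positivity)]
  field_simp

/-- A planar law whose linear functionals are centered Gaussian with isotropic variance is
a product of two Gaussian measures. -/
lemma map_eq_prod_gaussianReal {Ω : Type*} [MeasurableSpace Ω] (P : Measure Ω)
    [IsProbabilityMeasure P] (D : Ω → ℝ × ℝ) (hD : Measurable D) (v : NNReal)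
    (h : ∀ x y : ℝ, P.map (fun ω => x * (D ω).1 + y * (D ω).2)
      = gaussianReal 0 (((x ^ 2 + y ^ 2) * v).toNNReal)) :
    P.map D = (gaussianReal 0 v).prod (gaussianReal 0 v) := by
  have : IsProbabilityMeasure (P.map D) := Measure.isProbabilityMeasure_map hD.aemeasurable
  refine Measure.ext_of_charFunDual (funext fun L => ?_)
  rw [charFunDual_prod]
  simp only [charFunDual_eq_charFun_map_one]
  rw [Measure.map_map (by fun_prop) hD, gaussianReal_map_continuousLinearMap,
    gaussianReal_map_continuousLinearMap]
  have hL : L ∘ D = fun ω => L (1, 0) * (D ω).1 + L (0, 1) * (D ω).2 := by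
    funext ω
    have hdec : D ω = (D ω).1 • ((1, 0) : ℝ × ℝ) + (D ω).2 • ((0, 1) : ℝ × ℝ) := by
      ext <;> simp
    conv_lhs => rw [Function.comp_apply, hdec, map_add, map_smul, map_smul]
    simp only [smul_eq_mul, mul_comm]
  rw [hL, h, charFun_gaussianReal, charFun_gaussianReal, charFun_gaussianReal, ← Complex.exp_add]
  congr 1
  have h1 : (0 : ℝ) ≤ (L (1, 0) ^ 2 + L (0, 1) ^ 2) * v := by positivity
  simp only [ContinuousLinearMap.comp_apply, ContinuousLinearMap.inl_apply,
    ContinuousLinearMap.inr_apply, NNReal.coe_mul, Real.coe_toNNReal _ h1,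
    Real.coe_toNNReal _ (sq_nonneg _), map_zero]
  push_cast
  ring

/-- The mean of the heat kernel at an increment of a planar Brownian bridge. -/
lemma integral_pHeat_bridge_increment {Ω : Type*} [MeasurableSpace Ω] (P : Measure Ω)
    [IsProbabilityMeasure P] {t r s ε : ℝ} (ht : 0 < t) (hr : 0 ≤ r) (hrs : r ≤ s) (hst : s ≤ t)
    (hε : 0 < ε) (X : ℝ → Ω → ℝ × ℝ) (hmeas : Measurable (fun p : ℝ × Ω => X p.1 p.2))
    (hGauss : ∀ (m : ℕ) (ts : Fin m → ℝ), (∀ i, ts i ∈ Set.Icc 0 t) →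
      ∀ e : Fin m → ℝ × ℝ,
        Measure.map
            (fun ω => ∑ i, ((e i).1 * (X (ts i) ω).1 + (e i).2 * (X (ts i) ω).2)) P
          = gaussianReal 0
              (Real.toNNReal (∑ i, ∑ j,
                ((e i).1 * (e j).1 + (e i).2 * (e j).2) *
                  (min (ts i) (ts j) - ts i * ts j / t)))) :
    ∫ ω, pHeat ε (X s ω - X r ω) ∂P
      = (2 * Real.pi * (((s - r) - (s - r) ^ 2 / t).toNNReal + ε))⁻¹ := by
  have hX (u : ℝ) : Measurable (X u) := hmeas.comp measurable_prodMk_left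
  have hD : Measurable (fun ω => X s ω - X r ω) := (hX s).sub (hX r)
  have hv : 0 ≤ (s - r) - (s - r) ^ 2 / t := by
    rw [sub_nonneg, div_le_iff₀ ht]
    nlinarith
  have hmap := map_eq_prod_gaussianReal P _ hD ((s - r) - (s - r) ^ 2 / t).toNNReal fun x y => by
    have hts : ∀ i, (![s, r] : Fin 2 → ℝ) i ∈ Set.Icc 0 t := by
      intro i
      fin_cases i <;> simp <;> constructor <;> linarith
    have := hGauss 2 ![s, r] hts ![(x, y), (-x, -y)]
    simp only [Fin.sum_univ_two, Matrix.cons_val_zero, Matrix.cons_val_one, min_self,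
      min_eq_left hrs, min_eq_right hrs] at this
    convert this using 2
    · ext ω
      simp only [Prod.fst_sub, Prod.snd_sub]
      ring
    · rw [Real.coe_toNNReal _ hv]
      congr 1
      ring
  rw [← integral_pHeat_gaussianReal_prod hε, ← hmap, integral_map hD.aemeasurable]
  unfold pHeat
  fun_prop

/-- On a compact subinterval of `(0, t)`, the Green density of the bridge increments integrates
to a difference of logarithms. -/
lemma integral_inv_bridge_variance {t p q : ℝ} (hp : 0 < p) (hpq : p ≤ q) (hqt : q < t) :
    IntervalIntegrable (fun u => (2 * Real.pi * (u - u ^ 2 / t))⁻¹) volume p q ∧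
    ∫ u in p..q, (2 * Real.pi * (u - u ^ 2 / t))⁻¹ = (2 * Real.pi)⁻¹ *
      ((Real.log q - Real.log (t - q)) - (Real.log p - Real.log (t - p))) := by
  have ht : 0 < t := by linarith
  have hpos (u : ℝ) (hu : u ∈ Set.uIcc p q) : 0 < u ∧ 0 < t - u := by
    rw [Set.uIcc_of_le hpq] at hu
    constructor <;> linarith [hu.1, hu.2]
  have hvar (u : ℝ) : u - u ^ 2 / t = u * (t - u) / t := by
    field_simp
  have hint : IntervalIntegrable (fun u => (2 * Real.pi * (u - u ^ 2 / t))⁻¹) volume p q := by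
    refine ContinuousOn.intervalIntegrable (ContinuousOn.inv₀ (by fun_prop) fun u hu => ?_)
    obtain ⟨h1, h2⟩ := hpos u hu
    rw [hvar]
    positivity
  refine ⟨hint, ?_⟩
  rw [mul_sub]
  refine intervalIntegral.integral_eq_sub_of_hasDerivAt
    (f := fun u => (2 * Real.pi)⁻¹ * (Real.log u - Real.log (t - u))) (fun u hu => ?_) hint
  obtain ⟨h1, h2⟩ := hpos u hu
  have hderiv := ((Real.hasDerivAt_log h1.ne').sub
    (((hasDerivAt_id u).const_sub t).log h2.ne')).const_mul (2 * Real.pi)⁻¹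
  convert! hderiv using 1
  rw [hvar]
  simp only [id]
  field_simp
  ring

/-- The regularized Green density is dominated by the Green density. -/
lemma norm_inv_bridge_variance_add_le {t u ε : ℝ} (hu : 0 < u) (hut : u < t) (hε : 0 < ε) :
    ‖(2 * Real.pi * (((u - u ^ 2 / t).toNNReal : ℝ) + ε))⁻¹‖
      ≤ (2 * Real.pi * (u - u ^ 2 / t))⁻¹ := by
  have ht : 0 < t := hu.trans hut
  have hv : 0 < u - u ^ 2 / t := by
    rw [sub_pos, div_lt_iff₀ ht]
    nlinarith
  rw [Real.norm_of_nonneg (by positivity), Real.coe_toNNReal _ hv.le]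
  gcongr
  linarith

lemma continuous_inv_bridge_variance_add {t ε : ℝ} (hε : 0 < ε) :
    Continuous fun u : ℝ => (2 * Real.pi * (((u - u ^ 2 / t).toNNReal : ℝ) + ε))⁻¹ := by
  refine Continuous.inv₀ (by fun_prop) fun u => ?_
  positivity

lemma tendsto_inv_bridge_variance_add {t u : ℝ} (hu : 0 < u) (hut : u < t) :
    Tendsto (fun ε : ℝ => (2 * Real.pi * (((u - u ^ 2 / t).toNNReal : ℝ) + ε))⁻¹) (𝓝[>] 0)
      (𝓝 (2 * Real.pi * (u - u ^ 2 / t))⁻¹) := by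
  have ht : 0 < t := hu.trans hut
  have hv : 0 < u - u ^ 2 / t := by
    rw [sub_pos, div_lt_iff₀ ht]
    nlinarith
  rw [Real.coe_toNNReal _ hv.le]
  have hcont : ContinuousAt (fun ε : ℝ => (2 * Real.pi * (u - u ^ 2 / t + ε))⁻¹) 0 := by
    refine ContinuousAt.inv₀ (by fun_prop) ?_
    rw [add_zero]
    positivity
  have h := hcont.tendsto
  rw [add_zero] at h
  exact h.mono_left nhdsWithin_le_nhds

/-- Removing the regularization of the Green density in the double integral. -/
lemma tendsto_integral_inv_bridge_variance_add {t a b c d : ℝ} (ha : 0 ≤ a) (hab : a ≤ b)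
    (hbc : b ≤ c) (hcd : c ≤ d) (hdt : d ≤ t) :
    Tendsto (fun ε : ℝ => ∫ s in c..d, ∫ r in a..b,
        (2 * Real.pi * ((((s - r) - (s - r) ^ 2 / t).toNNReal : ℝ) + ε))⁻¹)
      (𝓝[>] 0)
      (𝓝 ((2 * Real.pi)⁻¹ *
        ((∫ s in (c - a)..(d - a), (Real.log s - Real.log (t - s)))
          - ∫ s in (c - b)..(d - b), (Real.log s - Real.log (t - s))))) := by
  have hlog (p q : ℝ) :
      IntervalIntegrable (fun s => Real.log s - Real.log (t - s)) volume p q := by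
    refine intervalIntegral.intervalIntegrable_log'.sub ?_
    have h := (intervalIntegral.intervalIntegrable_log' (a := t - p) (b := t - q)).comp_sub_left t
    simpa using h
  have hshift (x : ℝ) : IntervalIntegrable
      (fun s => Real.log (s - x) - Real.log (t - (s - x))) volume c d := by
    simpa using (hlog (c - x) (d - x)).comp_sub_right x
  have hae : ∀ᵐ s : ℝ, s ∈ Set.uIoc c d → c < s ∧ s < d := by
    filter_upwards [Measure.ae_ne volume d] with s hs hmem
    rw [Set.uIoc_of_le hcd] at hmem
    exact ⟨hmem.1, lt_of_le_of_ne hmem.2 hs⟩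
  have hIoc {s u : ℝ} (hs : c < s ∧ s < d) (hu : u ∈ Set.Icc (s - b) (s - a)) : 0 < u ∧ u < t := by
    constructor <;> linarith [hu.1, hu.2, hs.1, hs.2]
  have hlimit : (2 * Real.pi)⁻¹ *
        ((∫ s in (c - a)..(d - a), (Real.log s - Real.log (t - s)))
          - ∫ s in (c - b)..(d - b), (Real.log s - Real.log (t - s)))
      = ∫ s in c..d, (2 * Real.pi)⁻¹ * ((Real.log (s - a) - Real.log (t - (s - a)))
          - (Real.log (s - b) - Real.log (t - (s - b)))) := by
    rw [intervalIntegral.integral_const_mul,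
      intervalIntegral.integral_sub (hshift a) (hshift b),
      intervalIntegral.integral_comp_sub_right (fun s => Real.log s - Real.log (t - s)),
      intervalIntegral.integral_comp_sub_right (fun s => Real.log s - Real.log (t - s))]
  rw [hlimit]
  refine intervalIntegral.tendsto_integral_filter_of_dominated_convergence _ ?_ ?_
    (((hshift a).sub (hshift b)).const_mul (2 * Real.pi)⁻¹) ?_
  · filter_upwards [self_mem_nhdsWithin] with ε hε
    have hcont := intervalIntegral.continuous_parametric_intervalIntegral_of_continuous'
      (μ := volume)
      (f := fun s r : ℝ => (2 * Real.pi * ((((s - r) - (s - r) ^ 2 / t).toNNReal : ℝ) + ε))⁻¹)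
      ((continuous_inv_bridge_variance_add hε).comp (continuous_fst.sub continuous_snd)) a b
    exact hcont.aestronglyMeasurable
  · filter_upwards [self_mem_nhdsWithin] with ε hε
    filter_upwards [hae] with s hs hmem
    specialize hs hmem
    obtain ⟨hint, heq⟩ := integral_inv_bridge_variance (t := t) (p := s - b) (q := s - a)
      (by linarith) (by linarith) (by linarith)
    rw [← heq, intervalIntegral.integral_comp_sub_left
      (fun u => (2 * Real.pi * (((u - u ^ 2 / t).toNNReal : ℝ) + ε))⁻¹)]
    refine intervalIntegral.norm_integral_le_of_norm_le (by linarith) ?_ hint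
    refine ae_of_all _ fun u hu => ?_
    obtain ⟨h0, h1⟩ := hIoc hs (Set.Ioc_subset_Icc_self hu)
    exact norm_inv_bridge_variance_add_le h0 h1 hε
  · filter_upwards [hae] with s hs hmem
    specialize hs hmem
    have hle : s - b ≤ s - a := by linarith
    obtain ⟨hint, heq⟩ := integral_inv_bridge_variance (t := t) (p := s - b) (q := s - a)
      (by linarith) hle (by linarith)
    have hcomp (ε : ℝ) := intervalIntegral.integral_comp_sub_left (a := a) (b := b)
      (fun u => (2 * Real.pi * (((u - u ^ 2 / t).toNNReal : ℝ) + ε))⁻¹) s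
    simp_rw [hcomp]
    rw [← heq]
    refine intervalIntegral.tendsto_integral_filter_of_dominated_convergence _ ?_ ?_ hint ?_
    · filter_upwards [self_mem_nhdsWithin] with ε hε
      exact (continuous_inv_bridge_variance_add hε).aestronglyMeasurable
    · filter_upwards [self_mem_nhdsWithin] with ε hε
      refine ae_of_all _ fun u hu => ?_
      rw [Set.uIoc_of_le hle] at hu
      obtain ⟨h0, h1⟩ := hIoc hs (Set.Ioc_subset_Icc_self hu)
      exact norm_inv_bridge_variance_add_le h0 h1 hε
    · refine ae_of_all _ fun u hu => ?_
      rw [Set.uIoc_of_le hle] at hu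
      obtain ⟨h0, h1⟩ := hIoc hs (Set.Ioc_subset_Icc_self hu)
      exact tendsto_inv_bridge_variance_add h0 h1

/-- For a two-dimensional Brownian bridge `X` on `[0, t]` (from `0` to `0`)
and `0 ≤ a ≤ b ≤ c ≤ d ≤ t`,
`lim_{ε → 0+} ∫_c^d ∫_a^b E[p_ε(X_s - X_r)] dr ds
  = (2π)⁻¹ [∫_{c-a}^{d-a} (log s - log(t-s)) ds - ∫_{c-b}^{d-b} (log s - log(t-s)) ds]`.
The Gaussianity of finite families is expressed through the law of all linear functionals. -/
theorem stmt_6 {Ω : Type*} [MeasurableSpace Ω] (P : Measure Ω) [IsProbabilityMeasure P]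
    (t a b c d : ℝ) (ht : 0 < t) (ha : 0 ≤ a) (hab : a ≤ b) (hbc : b ≤ c) (hcd : c ≤ d)
    (hdt : d ≤ t)
    (X : ℝ → Ω → ℝ × ℝ) (hmeas : Measurable (fun p : ℝ × Ω => X p.1 p.2))
    (hGauss : ∀ (m : ℕ) (ts : Fin m → ℝ), (∀ i, ts i ∈ Set.Icc 0 t) →
      ∀ e : Fin m → ℝ × ℝ,
        Measure.map
            (fun ω => ∑ i, ((e i).1 * (X (ts i) ω).1 + (e i).2 * (X (ts i) ω).2)) P
          = gaussianReal 0
              (Real.toNNReal (∑ i, ∑ j,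
                ((e i).1 * (e j).1 + (e i).2 * (e j).2) *
                  (min (ts i) (ts j) - ts i * ts j / t)))) :
    Tendsto (fun ε : ℝ =>
        ∫ s in c..d, ∫ r in a..b, ∫ ω, pHeat ε (X s ω - X r ω) ∂P)
      (𝓝[>] 0)
      (𝓝 ((2 * Real.pi)⁻¹ *
        ((∫ s in (c - a)..(d - a), (Real.log s - Real.log (t - s)))
          - ∫ s in (c - b)..(d - b), (Real.log s - Real.log (t - s))))) := by
  refine (tendsto_integral_inv_bridge_variance_add ha hab hbc hcd hdt).congr' ?_
  filter_upwards [self_mem_nhdsWithin] with ε hε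
  refine intervalIntegral.integral_congr fun s hs => intervalIntegral.integral_congr fun r hr => ?_
  rw [Set.uIcc_of_le hcd] at hs
  rw [Set.uIcc_of_le hab] at hr
  exact (integral_pHeat_bridge_increment P ht (ha.trans hr.1) (hr.2.trans (hbc.trans hs.1))
    (hs.2.trans hdt) hε X hmeas hGauss).symm
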